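/- Let E be a real Banach space, let a < b be real numbers, and let w : ℝ → E be twice continuously differentiable on [a, b]. Then ‖(w(b) − w(a))/(b − a) − w′(b)‖² ≤ ((b − a)/3) ∫_a^b ‖w″(s)‖² ds. -/

import Mathlib

open intervalIntegral

/-- Cauchy–Schwarz inequality for the interval integral of continuous real functions. -/
theorem sq_intervalIntegral_mul_le {a b : ℝ} (hab : a ≤ b) {f g : ℝ → ℝ}
    (hf : ContinuousOn f (Set.Icc a b)) (hg : ContinuousOn g (Set.Icc a b)) :
    (∫ s in a..b, f s * g s) ^ 2 ≤ (∫ s in a..b, f s ^ 2) * ∫ s in a..b, g s ^ 2 := by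
  rw [← Set.uIcc_of_le hab] at hf hg
  have hff : IntervalIntegrable (fun s ↦ f s ^ 2) MeasureTheory.volume a b :=
    (hf.pow 2).intervalIntegrable
  have hfg : IntervalIntegrable (fun s ↦ f s * g s) MeasureTheory.volume a b :=
    (hf.mul hg).intervalIntegrable
  have hgg : IntervalIntegrable (fun s ↦ g s ^ 2) MeasureTheory.volume a b :=
    (hg.pow 2).intervalIntegrable
  have key := discrim_le_zero (a := ∫ s in a..b, f s ^ 2) (b := 2 * ∫ s in a..b, f s * g s)
    (c := ∫ s in a..b, g s ^ 2) fun x ↦ by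
      have h : 0 ≤ ∫ s in a..b, (x * f s + g s) ^ 2 :=
        intervalIntegral.integral_nonneg hab fun s _ ↦ sq_nonneg _
      have e : (fun s ↦ (x * f s + g s) ^ 2) =
          fun s ↦ (x * x) * f s ^ 2 + (2 * x) * (f s * g s) + g s ^ 2 := by
        ext s; ring
      rw [e, intervalIntegral.integral_add ((hff.const_mul _).add (hfg.const_mul _)) hgg,
        intervalIntegral.integral_add (hff.const_mul _) (hfg.const_mul _),
        intervalIntegral.integral_const_mul, intervalIntegral.integral_const_mul] at h
      linarith
  unfold discrim at key
  linarith

/-- First-order Taylor formula at the right endpoint, with integral remainder. -/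
theorem intervalIntegral_sub_smul_deriv {E : Type*} [NormedAddCommGroup E] [NormedSpace ℝ E]
    [CompleteSpace E] {a b : ℝ} (hab : a ≤ b) {w w' w'' : ℝ → E}
    (hw : ∀ s ∈ Set.Icc a b, HasDerivWithinAt w (w' s) (Set.Icc a b) s)
    (hw' : ∀ s ∈ Set.Icc a b, HasDerivWithinAt w' (w'' s) (Set.Icc a b) s)
    (hcont : ContinuousOn w'' (Set.Icc a b)) :
    ∫ s in a..b, (s - a) • w'' s = (b - a) • w' b - (w b - w a) := by
  have hF : ∀ s ∈ Set.Icc a b, HasDerivWithinAt (fun s ↦ (s - a) • w' s - w s)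
      ((s - a) • w'' s) (Set.Icc a b) s := fun s hs ↦ by
    convert! (((hasDerivWithinAt_id s _).sub_const a).smul (hw' s hs)).sub (hw s hs) using 1
    simp
  have hint : ContinuousOn (fun s ↦ (s - a) • w'' s) (Set.uIcc a b) := by
    rw [Set.uIcc_of_le hab]
    fun_prop
  rw [intervalIntegral.integral_eq_sub_of_hasDerivAt_of_le hab
    (fun s hs ↦ (hF s hs).continuousWithinAt)
    (fun s hs ↦ (hF s (Set.Ioo_subset_Icc_self hs)).hasDerivAt (Icc_mem_nhds hs.1 hs.2))
    hint.intervalIntegrable]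
  simp only [sub_self, zero_smul]
  abel

/-- Backward-Euler consistency estimate (used for (tt5) of Lemma 4.3): for `w` twice
continuously differentiable on `[a,b]`,
`‖(w(b)−w(a))/(b−a) − w′(b)‖² ≤ ((b−a)/3) ∫_a^b ‖w″(s)‖² ds`. -/
theorem stmt9 {E : Type*} [NormedAddCommGroup E] [NormedSpace ℝ E] [CompleteSpace E]
    (a b : ℝ) (hab : a < b) (w w' w'' : ℝ → E)
    (hw : ∀ s ∈ Set.Icc a b, HasDerivWithinAt w (w' s) (Set.Icc a b) s)
    (hw' : ∀ s ∈ Set.Icc a b, HasDerivWithinAt w' (w'' s) (Set.Icc a b) s)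
    (hcont : ContinuousOn w'' (Set.Icc a b)) :
    ‖(b - a)⁻¹ • (w b - w a) - w' b‖ ^ 2 ≤
      (b - a) / 3 * ∫ s in a..b, ‖w'' s‖ ^ 2 := by
  have hL : 0 < b - a := sub_pos.2 hab
  have hrep : (b - a)⁻¹ • (w b - w a) - w' b =
      -((b - a)⁻¹ • ∫ s in a..b, (s - a) • w'' s) := by
    rw [intervalIntegral_sub_smul_deriv hab.le hw hw' hcont, smul_sub _ ((b - a) • w' b),
      inv_smul_smul₀ hL.ne']
    abel
  have hnorm : ‖∫ s in a..b, (s - a) • w'' s‖ ≤ ∫ s in a..b, (s - a) * ‖w'' s‖ := by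
    refine (intervalIntegral.norm_integral_le_integral_norm hab.le).trans_eq ?_
    refine intervalIntegral.integral_congr fun s hs ↦ ?_
    rw [Set.uIcc_of_le hab.le] at hs
    simp [norm_smul, abs_of_nonneg (sub_nonneg.2 hs.1)]
  have hkernel : ∫ s in a..b, (s - a) ^ 2 = (b - a) ^ 3 / 3 := by
    rw [intervalIntegral.integral_comp_sub_right (fun s ↦ s ^ 2), integral_pow]
    norm_num
  have hcs := sq_intervalIntegral_mul_le hab.le (f := fun s ↦ s - a) (by fun_prop) hcont.norm
  rw [hkernel] at hcs
  rw [hrep, norm_neg, norm_smul, Real.norm_of_nonneg (inv_nonneg.2 hL.le), mul_pow]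
  calc (b - a)⁻¹ ^ 2 * ‖∫ s in a..b, (s - a) • w'' s‖ ^ 2
      ≤ (b - a)⁻¹ ^ 2 * ((b - a) ^ 3 / 3 * ∫ s in a..b, ‖w'' s‖ ^ 2) := by
        gcongr
        exact (pow_le_pow_left₀ (norm_nonneg _) hnorm 2).trans hcs
    _ = (b - a) / 3 * ∫ s in a..b, ‖w'' s‖ ^ 2 := by
        field_simp
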